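/- arXiv:1803.02415 — 2 statements merged into one kernel-verified Lean document; each statement's English description precedes it below -/
import Mathlib

section
/- Let T ⊆ ℝ^m, let Q : T × ℝ^d → ℝ be jointly continuous, let t ∈ T, z̄ ∈ ℝ^d, and let Δ ∈ ℝ^m be such that t + hΔ ∈ T for all sufficiently small h ≥ 0 and the one-sided directional derivative lim_{h↓0} (Q(t + hΔ, z̄) − Q(t, z̄))/h exists and is strictly negative. Then there exist an open neighborhood N of t in T and an open neighborhood W of z̄ in ℝ^d such that V(N,z) > V(T,z) for every z ∈ W; in particular, {z ∈ W : V(N,z) = V(T,z)} = ∅. -/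
open MeasureTheory

/-- The value function `V(K,z) = inf_{t ∈ K} Q(t,z)`, with values in the extended reals. -/
noncomputable def valueFn {d m : ℕ} (Q : (Fin m → ℝ) → (Fin d → ℝ) → ℝ)
    (K : Set (Fin m → ℝ)) (z : Fin d → ℝ) : EReal :=
  ⨅ t ∈ K, ((Q t z : ℝ) : EReal)

/-- Lemma 5: a point at which the objective strictly decreases in some
feasible direction cannot be a global minimizer, uniformly over a neighborhood of the
realization `zb`. -/
theorem descent_direction_excludes_minimizer (m d : ℕ) (T : Set (Fin m → ℝ))
    (Q : (Fin m → ℝ) → (Fin d → ℝ) → ℝ)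
    (hQ : ContinuousOn (fun p : (Fin m → ℝ) × (Fin d → ℝ) => Q p.1 p.2)
      (T ×ˢ (Set.univ : Set (Fin d → ℝ))))
    (t : Fin m → ℝ) (ht : t ∈ T) (zb : Fin d → ℝ) (Δ : Fin m → ℝ)
    (hfeas : ∃ ε > (0:ℝ), ∀ h : ℝ, 0 ≤ h → h ≤ ε → t + h • Δ ∈ T)
    (L : ℝ) (hL : L < 0)
    (hderiv : Filter.Tendsto (fun h : ℝ => (Q (t + h • Δ) zb - Q t zb) / h)
      (nhdsWithin 0 (Set.Ioi 0)) (nhds L)) :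
    ∃ N : Set (Fin m → ℝ), ∃ W : Set (Fin d → ℝ),
      IsOpen N ∧ t ∈ N ∧ IsOpen W ∧ zb ∈ W ∧
      (∀ z ∈ W, valueFn Q T z < valueFn Q (N ∩ T) z) ∧
      {z ∈ W | valueFn Q (N ∩ T) z = valueFn Q T z} = ∅ := by
  obtain ⟨ε, hε, hT⟩ := hfeas
  obtain ⟨h, hneg, hpos, hle⟩ :=
    ((hderiv.eventually_lt_const hL).and (Ioc_mem_nhdsGT hε)).exists
  have hs : t + h • Δ ∈ T := hT h hpos.le hle
  have hdesc : Q (t + h • Δ) zb < Q t zb := by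
    have := (div_lt_iff₀ hpos).1 hneg
    linarith
  obtain ⟨a, hsa, hat⟩ := exists_between hdesc
  obtain ⟨c, hac, hct⟩ := exists_between hat
  have hcont : Continuous fun z => Q (t + h • Δ) z :=
    hQ.comp_continuous (f := fun z => (t + h • Δ, z)) (by fun_prop) fun z => ⟨hs, Set.mem_univ z⟩
  have hnear : ∀ᶠ p in nhds (t, zb), p ∈ T ×ˢ (Set.univ : Set (Fin d → ℝ)) → c < Q p.1 p.2 :=
    eventually_nhdsWithin_iff.1 ((hQ (t, zb) ⟨ht, Set.mem_univ zb⟩).eventually_const_lt hct)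
  obtain ⟨N, W, hN, htN, hW, hzW, hNW⟩ := mem_nhds_prod_iff'.1 hnear
  have hlt : ∀ z ∈ W ∩ {z | Q (t + h • Δ) z < a},
      valueFn Q T z < valueFn Q (N ∩ T) z := by
    rintro z ⟨hz, hza : Q (t + h • Δ) z < a⟩
    calc valueFn Q T z ≤ (Q (t + h • Δ) z : EReal) := iInf₂_le _ hs
      _ < (c : EReal) := EReal.coe_lt_coe_iff.2 (hza.trans hac)
      _ ≤ valueFn Q (N ∩ T) z := le_iInf₂ fun s hsNT =>
        EReal.coe_le_coe_iff.2 (hNW (Set.mk_mem_prod hsNT.1 hz) ⟨hsNT.2, Set.mem_univ z⟩).le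
  exact ⟨N, W ∩ {z | Q (t + h • Δ) z < a}, hN, htN,
    hW.inter (isOpen_lt hcont continuous_const), ⟨hzW, hsa⟩, hlt,
    Set.eq_empty_of_forall_notMem fun z hz => (hlt z hz.1).ne' hz.2⟩
end

section
/- Let n and J be positive integers with J² ≤ n, let U_J = {(τ,μ) ∈ ℝ^J × ℝ^J : τ_j > 0 for all j and Σ_{j=1}^J τ_j = 1} denote the unrestricted mixture parameter space (no ordering of the means), and let P be a probability measure on ℝ^n absolutely continuous with respect to Lebesgue measure. Then for P-almost every z ∈ ℝ^n the following holds: if (τ*,μ*) ∈ U_J is a global minimizer of Q_J(·,·,z) over U_J, then the set of global minimizers of Q_J(·,·,z) over U_J is exactly {(ς*,ν*) ∈ U_J : for every k = 1,…,J, Σ_{j=1}^J ς*_j·1{ν*_j = μ*_k} = Σ_{j=1}^J τ*_j·1{μ*_j = μ*_k}}. -/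
open MeasureTheory

/-- The standard normal density `φ(x) = (2π)^{-1/2} exp(-x²/2)`. -/
noncomputable def stdNormalPdf (x : ℝ) : ℝ :=
  (Real.sqrt (2 * Real.pi))⁻¹ * Real.exp (-(x ^ 2) / 2)

/-- The unrestricted mixture parameter space (no ordering of the means). -/
def unrestrictedMixtureSpace (J : ℕ) : Set ((Fin J → ℝ) × (Fin J → ℝ)) :=
  {p | (∀ j, 0 < p.1 j) ∧ (∑ j, p.1 j) = 1}

/-- The negative log-likelihood of a `J`-component normal location mixture. -/
noncomputable def mixtureNegLogLik (n J : ℕ) (p : (Fin J → ℝ) × (Fin J → ℝ))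
    (z : Fin n → ℝ) : ℝ :=
  -∑ i, Real.log (∑ j, p.1 j * stdNormalPdf (z i - p.2 j))

open Finset in
/-- A nontrivial combination of `m` exponentials with distinct exponents has fewer than `m` real
zeros. -/
lemma expSum_coeff_eq_zero_of_strictMono (m : ℕ) : ∀ (s : Finset ℝ), #s = m → ∀ (c : ℝ → ℝ)
    (x : Fin m → ℝ), StrictMono x → (∀ i, ∑ l ∈ s, c l * Real.exp (l * x i) = 0) →
    ∀ l ∈ s, c l = 0 := by
  induction m with
  | zero =>
    intro s hs c x _ _ l hl
    simp [Finset.card_eq_zero.mp hs] at hl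
  | succ m ih =>
    intro s hs c x hx h
    obtain ⟨a, ha⟩ : s.Nonempty := Finset.card_pos.mp (by omega)
    let F : ℝ → ℝ := fun y => ∑ l ∈ s, c l * Real.exp ((l - a) * y)
    have hF : ∀ i, F (x i) = 0 := by
      intro i
      have : F (x i) = Real.exp (-(a * x i)) * ∑ l ∈ s, c l * Real.exp (l * x i) := by
        rw [Finset.mul_sum]
        refine Finset.sum_congr rfl fun l _ => ?_
        rw [mul_left_comm, ← Real.exp_add]
        ring_nf
      rw [this, h, mul_zero]
    have hd : ∀ y, HasDerivAt F (∑ l ∈ s, c l * (Real.exp ((l - a) * y) * (l - a))) y := by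
      intro y
      refine HasDerivAt.fun_sum fun l _ => ?_
      simpa using (((hasDerivAt_id y).const_mul (l - a)).exp).const_mul (c l)
    have hroll : ∀ i : Fin m, ∃ y ∈ Set.Ioo (x i.castSucc) (x i.succ),
        ∑ l ∈ s, c l * (Real.exp ((l - a) * y) * (l - a)) = 0 := fun i =>
      exists_hasDerivAt_eq_zero (hx i.castSucc_lt_succ)
        (fun y _ => (hd y).continuousAt.continuousWithinAt)
        ((hF _).trans (hF _).symm) fun y _ => hd y
    choose y hy hy0 using hroll
    have hy_mono : StrictMono y := by
      intro i j hij
      calc y i < x i.succ := (hy i).2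
        _ ≤ x j.castSucc := hx.monotone (Fin.succ_le_castSucc_iff.mpr hij)
        _ < y j := (hy j).1
    have key := ih (s.erase a) (by rw [Finset.card_erase_of_mem ha, hs]; rfl)
      (fun l => c l * (l - a)) y hy_mono fun i => by
        have : ∑ l ∈ s.erase a, c l * (l - a) * Real.exp (l * y i) =
            Real.exp (a * y i) * ∑ l ∈ s, c l * (Real.exp ((l - a) * y i) * (l - a)) := by
          rw [← Finset.add_sum_erase s _ ha, sub_self, mul_zero, mul_zero, zero_add,
            Finset.mul_sum]
          refine Finset.sum_congr rfl fun l _ => ?_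
          rw [show l * y i = a * y i + (l - a) * y i by ring, Real.exp_add]
          ring
        rw [this, hy0, mul_zero]
    have hne : ∀ l ∈ s, l ≠ a → c l = 0 := fun l hl hla =>
      (mul_eq_zero.mp (key l (Finset.mem_erase.mpr ⟨hla, hl⟩))).resolve_right (sub_ne_zero.mpr hla)
    intro l hl
    by_cases hla : l = a
    · subst hla
      have h0 := h 0
      rw [Finset.sum_eq_single_of_mem l hl fun b hb hbl => by rw [hne b hb hbl, zero_mul]] at h0
      exact (mul_eq_zero.mp h0).resolve_right (Real.exp_ne_zero _)
    · exact hne l hl hla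

/-- Grouping the terms of a sum according to the value of `l`. -/
lemma sum_mul_comp_eq_sum_fiber {ι : Type*} [Fintype ι] (a l : ι → ℝ) (g : ℝ → ℝ) (s : Finset ℝ)
    (hs : ∀ i, l i ∈ s) :
    ∑ i, a i * g (l i) = ∑ y ∈ s, (∑ i, if l i = y then a i else 0) * g y := by
  simp_rw [Finset.sum_mul]
  rw [Finset.sum_comm]
  refine Finset.sum_congr rfl fun i _ => ?_
  simp [ite_mul, hs i]

open Finset in
lemma expSum_fiber_eq_zero {ι : Type*} [Fintype ι] (a l : ι → ℝ) (t : Finset ℝ)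
    (ht : Fintype.card ι ≤ #t) (h : ∀ x ∈ t, ∑ i, a i * Real.exp (l i * x) = 0) (y : ℝ) :
    (∑ i, if l i = y then a i else 0) = 0 := by
  classical
  set s := Finset.univ.image l
  have hls : ∀ i, l i ∈ s := fun i => Finset.mem_image_of_mem l (Finset.mem_univ i)
  by_cases hy : y ∈ s
  · obtain ⟨u, hut, hu⟩ := Finset.exists_subset_card_eq
      ((Finset.card_image_le (s := Finset.univ) (f := l)).trans ht)
    refine expSum_coeff_eq_zero_of_strictMono _ s rfl
      (fun y => ∑ i, if l i = y then a i else 0) (u.orderEmbOfFin hu)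
      (OrderEmbedding.strictMono _) (fun i => ?_) y hy
    exact (sum_mul_comp_eq_sum_fiber a l (fun y => Real.exp (y * u.orderEmbOfFin hu i)) s
      hls).symm.trans (h _ (hut (u.orderEmbOfFin_mem hu i)))
  · refine Finset.sum_eq_zero fun i _ => if_neg ?_
    rintro rfl
    exact hy (hls i)

lemma LocallyLipschitz.ae_differentiableAt {E F : Type*} [NormedAddCommGroup E] [NormedSpace ℝ E]
    [FiniteDimensional ℝ E] [MeasurableSpace E] [BorelSpace E] [NormedAddCommGroup F]
    [NormedSpace ℝ F] [FiniteDimensional ℝ F] (μ : Measure E) [μ.IsAddHaarMeasure]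
    {f : E → F} (hf : LocallyLipschitz f) : ∀ᵐ x ∂μ, DifferentiableAt ℝ f x := by
  refine measure_null_of_locally_null _ fun x _ => ?_
  obtain ⟨K, t, ht, hK⟩ := hf x
  refine ⟨{y | ¬ DifferentiableAt ℝ f y} ∩ interior t,
    inter_mem_nhdsWithin _ (interior_mem_nhds.mpr ht), ?_⟩
  refine measure_mono_null ?_ (hK.ae_differentiableWithinAt_of_mem (μ := μ))
  rintro y ⟨hy, hyt⟩ hy'
  exact hy ((hy' (interior_subset hyt)).differentiableAt (mem_interior_iff_mem_nhds.mp hyt))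

lemma hasFDerivAt_eq_of_le_of_eq {E : Type*} [NormedAddCommGroup E] [NormedSpace ℝ E]
    {f W : E → ℝ} {f' : E →L[ℝ] ℝ} {x : E} (hle : ∀ y, f y ≤ W y) (heq : f x = W x)
    (hf : HasFDerivAt f f' x) (hW : DifferentiableAt ℝ W x) : f' = fderiv ℝ W x := by
  have hmin : IsLocalMin (fun y => W y - f y) x :=
    Filter.Eventually.of_forall fun y => by
      change W x - f x ≤ W y - f y
      linarith [hle y]
  exact (sub_eq_zero.mp (hmin.hasFDerivAt_eq_zero (hW.hasFDerivAt.sub hf))).symm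

lemma ConvexOn.ciSup {E ι : Type*} [AddCommGroup E] [Module ℝ E] [Nonempty ι] {s : Set E}
    {f : ι → E → ℝ} (hf : ∀ i, ConvexOn ℝ s (f i))
    (hb : ∀ x ∈ s, BddAbove (Set.range fun i => f i x)) :
    ConvexOn ℝ s fun x => ⨆ i, f i x := by
  refine ⟨(hf (Classical.arbitrary ι)).1, fun x hx y hy α β hα hβ hαβ => ciSup_le fun i => ?_⟩
  refine ((hf i).2 hx hy hα hβ hαβ).trans ?_
  simp only [smul_eq_mul]
  gcongr
  · exact le_ciSup (hb x hx) i
  · exact le_ciSup (hb y hy) i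

/-- The likelihood ratio of a normal location mixture against the standard normal density. -/
noncomputable def mixtureRatio {J : ℕ} (p : (Fin J → ℝ) × (Fin J → ℝ)) (x : ℝ) : ℝ :=
  ∑ j, p.1 j * Real.exp (-(p.2 j ^ 2) / 2) * Real.exp (p.2 j * x)

lemma mixtureRatio_pos {J : ℕ} {p : (Fin J → ℝ) × (Fin J → ℝ)}
    (hp : p ∈ unrestrictedMixtureSpace J) (x : ℝ) : 0 < mixtureRatio p x := by
  refine Finset.sum_pos (fun j _ => ?_) (Finset.nonempty_of_sum_ne_zero (hp.2 ▸ one_ne_zero))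
  have := hp.1 j
  positivity

lemma mixtureRatio_le {J : ℕ} {p : (Fin J → ℝ) × (Fin J → ℝ)}
    (hp : p ∈ unrestrictedMixtureSpace J) (x : ℝ) : mixtureRatio p x ≤ Real.exp (x ^ 2 / 2) := by
  calc mixtureRatio p x ≤ ∑ j, p.1 j * Real.exp (x ^ 2 / 2) := by
        refine Finset.sum_le_sum fun j _ => ?_
        rw [mul_assoc, ← Real.exp_add]
        refine mul_le_mul_of_nonneg_left (Real.exp_le_exp.mpr ?_) (hp.1 j).le
        nlinarith [sq_nonneg (x - p.2 j)]
    _ = Real.exp (x ^ 2 / 2) := by rw [← Finset.sum_mul, hp.2, one_mul]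

lemma hasDerivAt_mixtureRatio {J : ℕ} (p : (Fin J → ℝ) × (Fin J → ℝ)) (x : ℝ) :
    HasDerivAt (mixtureRatio p)
      (∑ j, p.1 j * Real.exp (-(p.2 j ^ 2) / 2) * (Real.exp (p.2 j * x) * p.2 j)) x := by
  refine HasDerivAt.fun_sum fun j _ => ?_
  simpa using (((hasDerivAt_id x).const_mul (p.2 j)).exp).const_mul
    (p.1 j * Real.exp (-(p.2 j ^ 2) / 2))

lemma convexOn_log_mixtureRatio {J : ℕ} {p : (Fin J → ℝ) × (Fin J → ℝ)}
    (hp : p ∈ unrestrictedMixtureSpace J) :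
    ConvexOn ℝ Set.univ fun x => Real.log (mixtureRatio p x) := by
  refine ⟨convex_univ, fun x _ y _ α β hα hβ hαβ => ?_⟩
  simp only [smul_eq_mul]
  rw [Real.log_le_iff_le_exp (mixtureRatio_pos hp _)]
  set a := Real.log (mixtureRatio p x) with ha
  set b := Real.log (mixtureRatio p y) with hb
  have hea : mixtureRatio p x = Real.exp a := (Real.exp_log (mixtureRatio_pos hp x)).symm
  have heb : mixtureRatio p y = Real.exp b := (Real.exp_log (mixtureRatio_pos hp y)).symm
  calc mixtureRatio p (α * x + β * y)
      ≤ ∑ j, Real.exp (α * a + β * b) * (α * Real.exp (-a) * (p.1 j *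
          Real.exp (-(p.2 j ^ 2) / 2) * Real.exp (p.2 j * x)) + β * Real.exp (-b) * (p.1 j *
          Real.exp (-(p.2 j ^ 2) / 2) * Real.exp (p.2 j * y))) := by
        refine Finset.sum_le_sum fun j _ => ?_
        have hc := convexOn_exp.2 (Set.mem_univ (p.2 j * x - a)) (Set.mem_univ (p.2 j * y - b))
          hα hβ hαβ
        simp only [smul_eq_mul] at hc
        have hsplit : Real.exp (p.2 j * (α * x + β * y)) = Real.exp (α * a + β * b) *
            Real.exp (α * (p.2 j * x - a) + β * (p.2 j * y - b)) := by
          rw [← Real.exp_add]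
          ring_nf
        have hx : Real.exp (p.2 j * x - a) = Real.exp (-a) * Real.exp (p.2 j * x) := by
          rw [← Real.exp_add]
          ring_nf
        have hy : Real.exp (p.2 j * y - b) = Real.exp (-b) * Real.exp (p.2 j * y) := by
          rw [← Real.exp_add]
          ring_nf
        have hw : 0 ≤ p.1 j * Real.exp (-(p.2 j ^ 2) / 2) * Real.exp (α * a + β * b) := by
          have := hp.1 j
          positivity
        rw [hsplit]
        have := mul_le_mul_of_nonneg_left hc hw
        rw [hx, hy] at this
        linarith
    _ = Real.exp (α * a + β * b) := by
        rw [← Finset.mul_sum, Finset.sum_add_distrib, ← Finset.mul_sum, ← Finset.mul_sum]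
        change _ * (_ * mixtureRatio p x + _ * mixtureRatio p y) = _
        rw [hea, heb, mul_assoc, mul_assoc, ← Real.exp_add, ← Real.exp_add]
        simp [hαβ]

lemma mixture_density_eq {J : ℕ} (p : (Fin J → ℝ) × (Fin J → ℝ)) (x : ℝ) :
    ∑ j, p.1 j * stdNormalPdf (x - p.2 j) = stdNormalPdf x * mixtureRatio p x := by
  unfold mixtureRatio stdNormalPdf
  rw [Finset.mul_sum]
  refine Finset.sum_congr rfl fun j _ => ?_
  rw [show -(x - p.2 j) ^ 2 / 2 = -(x ^ 2) / 2 + (-(p.2 j ^ 2) / 2 + p.2 j * x) by ring,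
    Real.exp_add, Real.exp_add]
  ring

lemma stdNormalPdf_pos (x : ℝ) : 0 < stdNormalPdf x := by
  unfold stdNormalPdf
  positivity

/-- The log-likelihood relative to the standard normal distribution. -/
noncomputable def relLogLik {n J : ℕ} (p : (Fin J → ℝ) × (Fin J → ℝ)) (z : Fin n → ℝ) : ℝ :=
  ∑ i, Real.log (mixtureRatio p (z i))

lemma mixtureNegLogLik_eq {n J : ℕ} {p : (Fin J → ℝ) × (Fin J → ℝ)}
    (hp : p ∈ unrestrictedMixtureSpace J) (z : Fin n → ℝ) :
    mixtureNegLogLik n J p z = -(∑ i, Real.log (stdNormalPdf (z i))) - relLogLik p z := by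
  unfold mixtureNegLogLik relLogLik
  simp_rw [mixture_density_eq]
  rw [← neg_add', ← Finset.sum_add_distrib]
  congr 1
  exact Finset.sum_congr rfl fun i _ =>
    Real.log_mul (stdNormalPdf_pos _).ne' (mixtureRatio_pos hp _).ne'

lemma convexOn_relLogLik {n J : ℕ} {p : (Fin J → ℝ) × (Fin J → ℝ)}
    (hp : p ∈ unrestrictedMixtureSpace J) :
    ConvexOn ℝ Set.univ fun z : Fin n → ℝ => relLogLik p z := by
  refine ⟨convex_univ, fun x _ y _ α β hα hβ hαβ => ?_⟩
  simp only [relLogLik, smul_eq_mul, Finset.mul_sum]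
  rw [← Finset.sum_add_distrib]
  exact Finset.sum_le_sum fun i _ =>
    (convexOn_log_mixtureRatio hp).2 (Set.mem_univ (x i)) (Set.mem_univ (y i)) hα hβ hαβ

lemma relLogLik_le {n J : ℕ} {p : (Fin J → ℝ) × (Fin J → ℝ)}
    (hp : p ∈ unrestrictedMixtureSpace J) (z : Fin n → ℝ) :
    relLogLik p z ≤ ∑ i, z i ^ 2 / 2 :=
  Finset.sum_le_sum fun _ _ =>
    (Real.log_le_iff_le_exp (mixtureRatio_pos hp _)).mpr (mixtureRatio_le hp _)

lemma hasFDerivAt_relLogLik {n J : ℕ} {p : (Fin J → ℝ) × (Fin J → ℝ)}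
    (hp : p ∈ unrestrictedMixtureSpace J) (z : Fin n → ℝ) :
    HasFDerivAt (fun z : Fin n → ℝ => relLogLik p z)
      (∑ i, (deriv (mixtureRatio p) (z i) / mixtureRatio p (z i)) •
        ContinuousLinearMap.proj (R := ℝ) (φ := fun _ : Fin n => ℝ) i) z := by
  refine HasFDerivAt.fun_sum fun i _ => ?_
  have hi := (ContinuousLinearMap.proj (R := ℝ) (φ := fun _ : Fin n => ℝ) i).hasFDerivAt (x := z)
  exact (((hasDerivAt_mixtureRatio p (z i)).differentiableAt.hasDerivAt).log
    (mixtureRatio_pos hp _).ne').comp_hasFDerivAt z hi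

lemma bddAbove_relLogLik {n J : ℕ} (z : Fin n → ℝ) :
    BddAbove (Set.range fun p : unrestrictedMixtureSpace J => relLogLik p.1 z) :=
  ⟨∑ i, z i ^ 2 / 2, by rintro _ ⟨p, rfl⟩; exact relLogLik_le p.2 z⟩

/-- The mass that the mixing distribution puts at `y`. -/
noncomputable def mixingMass {J : ℕ} (p : (Fin J → ℝ) × (Fin J → ℝ)) (y : ℝ) : ℝ :=
  ∑ j, if p.2 j = y then p.1 j else 0

lemma fiber_mixtureRatio_coeff {J : ℕ} (p : (Fin J → ℝ) × (Fin J → ℝ)) (y : ℝ) :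
    (∑ j, if p.2 j = y then p.1 j * Real.exp (-(p.2 j ^ 2) / 2) else 0) =
      mixingMass p y * Real.exp (-(y ^ 2) / 2) := by
  rw [mixingMass, Finset.sum_mul]
  refine Finset.sum_congr rfl fun j _ => ?_
  split_ifs with h
  · rw [h]
  · rw [zero_mul]

lemma sum_mixingMass {J : ℕ} {p : (Fin J → ℝ) × (Fin J → ℝ)}
    (hp : p ∈ unrestrictedMixtureSpace J) (s : Finset ℝ) (hs : ∀ j, p.2 j ∈ s) :
    ∑ y ∈ s, mixingMass p y = 1 := by
  have := sum_mul_comp_eq_sum_fiber p.1 p.2 (fun _ => 1) s hs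
  simp only [mul_one, hp.2] at this
  exact this.symm

open Finset in
/-- Two mixtures of `J` normals whose scores agree at `J ^ 2` distinct points have the same mixing
distribution. -/
lemma mixingMass_eq_of_deriv_eq {J : ℕ} {p q : (Fin J → ℝ) × (Fin J → ℝ)}
    (hp : p ∈ unrestrictedMixtureSpace J) (hq : q ∈ unrestrictedMixtureSpace J) (t : Finset ℝ)
    (ht : J ^ 2 ≤ #t) (h : ∀ x ∈ t, deriv (mixtureRatio p) x / mixtureRatio p x =
      deriv (mixtureRatio q) x / mixtureRatio q x) (y : ℝ) :
    mixingMass p y = mixingMass q y := by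
  classical
  let a : Fin J × Fin J → ℝ := fun i => p.1 i.1 * Real.exp (-(p.2 i.1 ^ 2) / 2) *
    (q.1 i.2 * Real.exp (-(q.2 i.2 ^ 2) / 2)) * (p.2 i.1 - q.2 i.2)
  let l : Fin J × Fin J → ℝ := fun i => p.2 i.1 + q.2 i.2
  have hwronsk : ∀ x, ∑ i, a i * Real.exp (l i * x) = deriv (mixtureRatio p) x * mixtureRatio q x -
      mixtureRatio p x * deriv (mixtureRatio q) x := by
    intro x
    rw [(hasDerivAt_mixtureRatio p x).deriv, (hasDerivAt_mixtureRatio q x).deriv, mixtureRatio,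
      mixtureRatio, Finset.sum_mul_sum, Finset.sum_mul_sum, ← Finset.sum_sub_distrib,
      Fintype.sum_prod_type]
    refine Finset.sum_congr rfl fun j _ => ?_
    rw [← Finset.sum_sub_distrib]
    refine Finset.sum_congr rfl fun k _ => ?_
    simp only [a, l, add_mul, Real.exp_add]
    ring
  have hfib := expSum_fiber_eq_zero a l t (by simpa [sq] using ht) fun x hx => by
    have := h x hx
    rw [div_eq_div_iff (mixtureRatio_pos hp x).ne' (mixtureRatio_pos hq x).ne'] at this
    rw [hwronsk, this]
    ring
  have hzero : ∀ x, deriv (mixtureRatio p) x * mixtureRatio q x -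
      mixtureRatio p x * deriv (mixtureRatio q) x = 0 := by
    intro x
    rw [← hwronsk, sum_mul_comp_eq_sum_fiber a l (fun y => Real.exp (y * x)) (Finset.univ.image l)
      fun i => Finset.mem_image_of_mem l (Finset.mem_univ i)]
    exact Finset.sum_eq_zero fun y _ => by rw [hfib, zero_mul]
  have hdp : Differentiable ℝ (mixtureRatio p) := fun x =>
    (hasDerivAt_mixtureRatio p x).differentiableAt
  have hdq : Differentiable ℝ (mixtureRatio q) := fun x =>
    (hasDerivAt_mixtureRatio q x).differentiableAt
  have hconst := is_const_of_deriv_eq_zero (f := fun x => mixtureRatio p x / mixtureRatio q x)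
    (hdp.div hdq fun x => (mixtureRatio_pos hq x).ne') fun x => by
      rw [deriv_fun_div (hdp x) (hdq x) (mixtureRatio_pos hq x).ne', hzero, zero_div]
  set c := mixtureRatio p 0 / mixtureRatio q 0
  have hprop : ∀ x, mixtureRatio p x = c * mixtureRatio q x := fun x =>
    (div_eq_iff (mixtureRatio_pos hq x).ne').mp (hconst x 0)
  have hmass : ∀ y, mixingMass p y = c * mixingMass q y := by
    intro y
    obtain ⟨u, hu⟩ := Infinite.exists_subset_card_eq ℝ (Fintype.card (Fin J ⊕ Fin J))
    have := expSum_fiber_eq_zero (ι := Fin J ⊕ Fin J)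
      (Sum.elim (fun j => p.1 j * Real.exp (-(p.2 j ^ 2) / 2))
        fun k => -c * (q.1 k * Real.exp (-(q.2 k ^ 2) / 2)))
      (Sum.elim p.2 q.2) u hu.ge (fun x _ => by
        have := hprop x
        simp only [mixtureRatio] at this
        rw [Fintype.sum_sum_type]
        simp only [Sum.elim_inl, Sum.elim_inr, mul_assoc (-c)]
        rw [← Finset.mul_sum, this]
        ring) y
    replace this : (∑ j, if p.2 j = y then p.1 j * Real.exp (-(p.2 j ^ 2) / 2) else 0) +
        ∑ k, (if q.2 k = y then -c * (q.1 k * Real.exp (-(q.2 k ^ 2) / 2)) else 0) = 0 :=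
      (Fintype.sum_sum_type _).symm.trans this
    rw [Finset.sum_congr rfl fun k _ => (mul_ite_zero (q.2 k = y) (-c)
        (q.1 k * Real.exp (-(q.2 k ^ 2) / 2))).symm,
      ← Finset.mul_sum, fiber_mixtureRatio_coeff, fiber_mixtureRatio_coeff] at this
    refine mul_right_cancel₀ (Real.exp_ne_zero (-(y ^ 2) / 2)) ?_
    linarith
  have hc : 1 = c := by
    have hp1 := sum_mixingMass hp (Finset.univ.image p.2 ∪ Finset.univ.image q.2)
      fun j => by simp
    have hq1 := sum_mixingMass hq (Finset.univ.image p.2 ∪ Finset.univ.image q.2)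
      fun j => by simp
    rw [Finset.sum_congr rfl fun y _ => hmass y, ← Finset.mul_sum, hq1, mul_one] at hp1
    exact hp1.symm
  rw [hmass, ← hc, one_mul]

lemma mixtureNegLogLik_eq_of_mixingMass_eq {n J : ℕ} {p q : (Fin J → ℝ) × (Fin J → ℝ)}
    (hp : p ∈ unrestrictedMixtureSpace J) (hq : q ∈ unrestrictedMixtureSpace J)
    (h : ∀ k, mixingMass q (p.2 k) = mixingMass p (p.2 k)) (z : Fin n → ℝ) :
    mixtureNegLogLik n J q z = mixtureNegLogLik n J p z := by
  classical
  set s := Finset.univ.image p.2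
  have hps : ∀ j, p.2 j ∈ s := fun j => Finset.mem_image_of_mem _ (Finset.mem_univ j)
  have hs : ∀ y ∈ s, mixingMass q y = mixingMass p y := by
    intro y hy
    obtain ⟨k, _, rfl⟩ := Finset.mem_image.mp hy
    exact h k
  have hqs : ∀ j, q.2 j ∈ s := by
    have hsum : ∑ j, (if q.2 j ∈ s then q.1 j else 0) = ∑ j, q.1 j := by
      have hq1 : ∑ y ∈ s, mixingMass q y = 1 := (Finset.sum_congr rfl hs).trans (sum_mixingMass hp s hps)
      simp only [mixingMass] at hq1
      rw [Finset.sum_comm] at hq1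
      rw [hq.2, ← hq1]
      exact Finset.sum_congr rfl fun j _ => (Finset.sum_ite_eq s (q.2 j) fun _ => q.1 j).symm
    intro j
    by_contra hj
    have hall := (Finset.sum_eq_sum_iff_of_le fun i _ => by
      split_ifs
      · exact le_rfl
      · exact (hq.1 i).le).mp hsum j (Finset.mem_univ j)
    rw [if_neg hj] at hall
    exact (hq.1 j).ne hall
  unfold mixtureNegLogLik
  congr 1
  refine Finset.sum_congr rfl fun i _ => congrArg Real.log ?_
  rw [sum_mul_comp_eq_sum_fiber q.1 q.2 (fun y => stdNormalPdf (z i - y)) s hqs,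
    sum_mul_comp_eq_sum_fiber p.1 p.2 (fun y => stdNormalPdf (z i - y)) s hps]
  exact Finset.sum_congr rfl fun y hy => congrArg (· * _) (hs y hy)

lemma ae_injective (n : ℕ) : ∀ᵐ z : Fin n → ℝ, Function.Injective z := by
  have h : ∀ i j : Fin n, ∀ᵐ z : Fin n → ℝ, z i = z j → i = j := by
    intro i j
    by_cases hij : i = j
    · simp [hij]
    · let L : (Fin n → ℝ) →ₗ[ℝ] ℝ :=
        LinearMap.proj (R := ℝ) (φ := fun _ => ℝ) i - LinearMap.proj j
      refine measure_mono_null (t := (LinearMap.ker L : Set (Fin n → ℝ))) (fun z hz => ?_)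
        (Measure.addHaar_submodule volume _ fun htop => ?_)
      · simp only [Set.mem_compl_iff, Set.mem_ofPred_eq, Classical.not_imp] at hz
        simp [L, hz.1]
      · have : Pi.single i (1 : ℝ) ∈ LinearMap.ker L := htop ▸ Submodule.mem_top
        simp [L, Ne.symm hij] at this
  filter_upwards [ae_all_iff.mpr fun i => ae_all_iff.mpr (h i)] with z hz
  exact fun i j => hz i j

/-- Corollary 1: for `P`-almost every `z`, given any global minimizer
`(τ*,μ*)` over the unrestricted parameter space, the set of global minimizers is exactly
the set of permutations/reweightings of `(τ*,μ*)`. -/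
theorem mixture_argmin_characterization (n J : ℕ) (hn : 0 < n) (hJ : 0 < J)
    (hJn : J ^ 2 ≤ n)
    (P : Measure (Fin n → ℝ)) [IsProbabilityMeasure P] (hP : P ≪ volume) :
    ∀ᵐ z ∂P, ∀ p ∈ unrestrictedMixtureSpace J,
      (∀ r ∈ unrestrictedMixtureSpace J,
        mixtureNegLogLik n J p z ≤ mixtureNegLogLik n J r z) →
      {q | q ∈ unrestrictedMixtureSpace J ∧
        ∀ r ∈ unrestrictedMixtureSpace J,
          mixtureNegLogLik n J q z ≤ mixtureNegLogLik n J r z} =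
      {q | q ∈ unrestrictedMixtureSpace J ∧
        ∀ k : Fin J, (∑ j, if q.2 j = p.2 k then q.1 j else 0) =
          (∑ j, if p.2 j = p.2 k then p.1 j else 0)} := by
  have hvol : ∀ᵐ z : Fin n → ℝ, Function.Injective z ∧ DifferentiableAt ℝ
      (fun z : Fin n → ℝ => ⨆ p : unrestrictedMixtureSpace J, relLogLik p.1 z) z := by
    refine (ae_injective n).and ?_
    rcases isEmpty_or_nonempty (unrestrictedMixtureSpace J) with hE | hE
    · exact .of_forall fun z => by simp [Real.iSup_of_isEmpty]
    · exact (ConvexOn.ciSup (fun p : unrestrictedMixtureSpace J => convexOn_relLogLik p.2)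
        fun z _ => bddAbove_relLogLik z).locallyLipschitz.ae_differentiableAt volume
  filter_upwards [hP.ae_le hvol] with z hz p hp hpmin
  obtain ⟨hinj, hdiff⟩ := hz
  have hderiv : ∀ r ∈ unrestrictedMixtureSpace J,
      (∀ r' ∈ unrestrictedMixtureSpace J,
        mixtureNegLogLik n J r z ≤ mixtureNegLogLik n J r' z) →
      (∑ i, (deriv (mixtureRatio r) (z i) / mixtureRatio r (z i)) •
        ContinuousLinearMap.proj (R := ℝ) (φ := fun _ : Fin n => ℝ) i) =
      fderiv ℝ (fun z : Fin n → ℝ => ⨆ p : unrestrictedMixtureSpace J, relLogLik p.1 z) z := by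
    intro r hr hmin
    have : Nonempty (unrestrictedMixtureSpace J) := ⟨⟨r, hr⟩⟩
    refine hasFDerivAt_eq_of_le_of_eq (fun w => le_ciSup (bddAbove_relLogLik w) ⟨r, hr⟩)
      (le_antisymm (le_ciSup (bddAbove_relLogLik z) ⟨r, hr⟩) (ciSup_le fun r' => ?_))
      (hasFDerivAt_relLogLik hr z) hdiff
    have := hmin r'.1 r'.2
    rw [mixtureNegLogLik_eq hr, mixtureNegLogLik_eq r'.2] at this
    linarith
  ext q
  constructor
  · rintro ⟨hq, hqmin⟩
    refine ⟨hq, fun k => ?_⟩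
    refine mixingMass_eq_of_deriv_eq hq hp (Finset.univ.image z)
      (by rwa [Finset.card_image_of_injective _ hinj, Finset.card_fin]) (fun x hx => ?_) _
    obtain ⟨i, _, rfl⟩ := Finset.mem_image.mp hx
    have := DFunLike.congr_fun ((hderiv q hq hqmin).trans (hderiv p hp hpmin).symm)
      (Pi.single i 1)
    simpa [Pi.single_apply] using this
  · rintro ⟨hq, hmass⟩
    refine ⟨hq, fun r hr => ?_⟩
    rw [mixtureNegLogLik_eq_of_mixingMass_eq hp hq hmass]
    exact hpmin r hr
end
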